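/- Let f : (−1,1) → ℝ be piecewise Lipschitz, extended by zero; set τ := 𝓗(arctan∘f), t₀(x) := e^{τ(x)}/(π·√(1−x²)·√(1+f(x)²)) on (−1,1) (zero outside), and for Im z > 0 let φ^±(z) := (1/π)·∫_{−1}^1 (±π/2 + arctan f(s))/(s − z) ds. Then for every smooth compactly supported function φ : ℝ² → ℝ one has the Green's representation: ∫_{−1}^1 t₀(x)·φ(x,0) dx = (1/(2π))·∫∫_{{(x,y) : y>0}} [ Re( e^{φ⁺(x+iy)} − e^{φ⁻(x+iy)} )·(∂φ/∂x)(x,y) − Im( e^{φ⁺(x+iy)} − e^{φ⁻(x+iy)} )·(∂φ/∂y)(x,y) ] dx dy. -/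

import Mathlib

open MeasureTheory Filter Set Complex
open scoped Real Topology ENNReal

/-- Hilbert transform: `HT h x = -(1/π) · lim_{ε→0⁺} ∫_{|x-s|>ε} h(s)/(x-s) ds`. -/
noncomputable def HT (h : ℝ → ℝ) (x : ℝ) : ℝ :=
  limUnder (𝓝[>] (0:ℝ)) (fun ε : ℝ =>
    -(1 / Real.pi) * ∫ s in {s : ℝ | ε < |x - s|}, h s / (x - s))

/-- A piecewise Lipschitz function on `(-1,1)`. -/
def PiecewiseLipschitzOn (f : ℝ → ℝ) : Prop :=
  ∃ (m : ℕ) (y : ℕ → ℝ), 0 < m ∧ y 0 = -1 ∧ y m = 1 ∧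
    (∀ j, j < m → y j < y (j + 1)) ∧
    ∀ j, j < m → ∃ K : NNReal, LipschitzOnWith K f (Set.Ioo (y j) (y (j + 1)))

/-- The Cauchy transform of a function on the line, without the usual normalisation. -/
noncomputable def cauchyTransform (h : ℝ → ℝ) (z : ℂ) : ℂ :=
  ∫ s : ℝ, (h s : ℂ) / ((s : ℂ) - z)

/-- `h` vanishes off `(-1,1)`, has oscillation at most `M`, and is Lipschitz with constant `K`
around any point, at the scale of the distance to the finite set `P`. -/
structure LipschitzAwayFrom (h : ℝ → ℝ) (P : Finset ℝ) (K M : ℝ) : Prop where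
  one_mem : (1 : ℝ) ∈ P
  nonneg : 0 ≤ K
  osc : ∀ a b, |h a - h b| ≤ M
  zero : ∀ s, s ∉ Ioo (-1 : ℝ) 1 → h s = 0
  lip : ∀ x d, (∀ p ∈ P, d ≤ |x - p|) → ∀ s, |s - x| < d → |h s - h x| ≤ K * |s - x|

namespace LipschitzAwayFrom

variable {h : ℝ → ℝ} {P : Finset ℝ} {K M : ℝ}

lemma abs_le (H : LipschitzAwayFrom h P K M) (s : ℝ) : |h s| ≤ M := by
  simpa [H.zero 1 (by simp)] using H.osc s 1

lemma exists_nearest (H : LipschitzAwayFrom h P K M) {x : ℝ} (hx : x ∉ P) :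
    ∃ p ∈ P, 0 < |x - p| ∧ ∀ q ∈ P, |x - p| ≤ |x - q| := by
  obtain ⟨p, hp, hmin⟩ := P.exists_min_image (fun p => |x - p|) ⟨1, H.one_mem⟩
  refine ⟨p, hp, abs_pos.2 (sub_ne_zero.2 ?_), hmin⟩
  rintro rfl
  exact hx hp

lemma continuousAt (H : LipschitzAwayFrom h P K M) {x : ℝ} (hx : x ∉ P) : ContinuousAt h x := by
  obtain ⟨p, -, hpos, hmin⟩ := H.exists_nearest hx
  rw [ContinuousAt, tendsto_iff_dist_tendsto_zero]
  have h1 : Tendsto (fun s => K * |s - x|) (𝓝 x) (𝓝 0) := by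
    have : Continuous (fun s => K * |s - x|) := by fun_prop
    simpa using this.tendsto x
  refine squeeze_zero' (Eventually.of_forall fun _ => dist_nonneg) ?_ h1
  filter_upwards [Metric.ball_mem_nhds x hpos] with s hs
  rw [Real.dist_eq]
  exact H.lip x _ hmin s (by simpa [Real.dist_eq] using hs)

lemma ae_notMem (P : Finset ℝ) : ∀ᵐ x : ℝ, x ∉ P :=
  measure_eq_zero_iff_ae_notMem.1 (P.finite_toSet.measure_zero volume)

lemma aestronglyMeasurable (H : LipschitzAwayFrom h P K M) :
    AEStronglyMeasurable h volume := by
  have hc : ContinuousOn h (P : Set ℝ)ᶜ := fun x hx =>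
    (H.continuousAt (by simpa using hx)).continuousWithinAt
  have := hc.aestronglyMeasurable (μ := volume) P.finite_toSet.measurableSet.compl
  rwa [Measure.restrict_eq_self_of_ae_mem] at this
  filter_upwards [ae_notMem P] with x hx
  simpa using hx

lemma integrable (H : LipschitzAwayFrom h P K M) : Integrable h := by
  have : IntegrableOn h (Ioo (-1) 1) :=
    Measure.integrableOn_of_bounded (M := M) (by simp) H.aestronglyMeasurable
      (Eventually.of_forall fun s => by simpa using H.abs_le s)
  refine this.integrable_of_forall_notMem_eq_zero H.zero

lemma integrable_shift (H : LipschitzAwayFrom h P K M) (x : ℝ) :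
    Integrable (fun u => h (x + u)) := H.integrable.comp_add_left x

end LipschitzAwayFrom

/-- Folding an integral over a symmetric set onto the positive half-line. -/
lemma setIntegral_lt_abs_eq_Ioi {k : ℝ → ℝ} {ε : ℝ} (hε : 0 ≤ ε)
    (hk : IntegrableOn k (Ioi ε)) (hk' : IntegrableOn (fun u => k (-u)) (Ioi ε)) :
    ∫ u in {u : ℝ | ε < |u|}, k u = ∫ u in Ioi ε, (k u + k (-u)) := by
  have hset : {u : ℝ | ε < |u|} = Iio (-ε) ∪ Ioi ε := by
    ext u
    simp only [mem_ofPred_eq, lt_abs, mem_union, mem_Iio, mem_Ioi]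
    constructor <;> rintro (h | h) <;> [right; left; right; left] <;> linarith
  have hdisj : Disjoint (Iio (-ε)) (Ioi ε) := by
    rw [Set.disjoint_left]
    intro u hu hu'
    simp only [mem_Iio, mem_Ioi] at hu hu'
    linarith
  have hneg : IntegrableOn k (Iic (-ε)) := by
    have := (integrable_indicator_iff measurableSet_Ioi).2 hk'
    have h2 := this.comp_neg
    have h3 : (fun u => (Ioi ε).indicator (fun u => k (-u)) (-u)) = (Iio (-ε)).indicator k := by
      ext u
      by_cases hu : u < -ε
      · rw [indicator_of_mem (mem_Ioi.2 (by linarith)), indicator_of_mem (mem_Iio.2 hu)]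
        simp
      · rw [indicator_of_notMem (notMem_Ioi.2 (by linarith)),
          indicator_of_notMem (by simpa using hu)]
    rw [h3, integrable_indicator_iff measurableSet_Iio] at h2
    exact (integrableOn_Iic_iff_integrableOn_Iio (by simp)).2 h2
  rw [hset, setIntegral_union hdisj measurableSet_Ioi (hneg.mono_set Iio_subset_Iic_self) hk,
    integral_add hk hk', integral_comp_neg_Ioi, integral_Iic_eq_integral_Iio, add_comm]

lemma integral_eq_setIntegral_Ioi {k : ℝ → ℝ} (hk : Integrable k) :
    ∫ u, k u = ∫ u in Ioi 0, (k u + k (-u)) := by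
  rw [← setIntegral_lt_abs_eq_Ioi le_rfl hk.integrableOn hk.comp_neg.integrableOn,
    ← setIntegral_univ]
  refine setIntegral_congr_set ?_
  have : ∀ᵐ u : ℝ, u ≠ 0 := by simp [ae_iff]
  filter_upwards [this] with u hu
  simp only [eq_iff_iff]
  exact ⟨fun _ => abs_pos.2 hu, fun _ => trivial⟩

namespace LipschitzAwayFrom

variable {h : ℝ → ℝ} {P : Finset ℝ} {K M : ℝ}

lemma truncated_integral_eq (H : LipschitzAwayFrom h P K M) (x : ℝ) {ε : ℝ} (hε : 0 < ε) :
    ∫ s in {s : ℝ | ε < |x - s|}, h s / (x - s)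
      = -∫ u in Ioi ε, (h (x + u) - h (x - u)) / u := by
  have key : ∀ k : ℝ → ℝ, Integrable k → IntegrableOn (fun u => k u / u) (Ioi ε) := by
    intro k hk
    refine (hk.integrableOn (s := Ioi ε)).mul_bdd (g := fun u => u⁻¹) (c := ε⁻¹)
      measurable_inv.aestronglyMeasurable ?_
    filter_upwards [ae_restrict_mem measurableSet_Ioi] with u hu
    have hu' : 0 < u := hε.trans hu
    rw [Real.norm_eq_abs, abs_of_pos (by positivity)]
    exact inv_anti₀ hε (le_of_lt hu)
  have h1 := (measurePreserving_add_left volume x).setIntegral_preimage_emb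
    (measurableEmbedding_addLeft x) (fun s => h s / (x - s)) {s : ℝ | ε < |x - s|}
  have h2 : (fun u => x + u) ⁻¹' {s : ℝ | ε < |x - s|} = {u : ℝ | ε < |u|} := by
    ext u; simp
  rw [← h1, h2, setIntegral_lt_abs_eq_Ioi hε.le, ← integral_neg]
  · refine integral_congr_ae (Eventually.of_forall fun u => ?_)
    rcases eq_or_ne u 0 with rfl | hu
    · simp
    · simp only [← sub_eq_add_neg]
      rw [show x - (x + u) = -u by ring, show x - (x - u) = u by ring]
      field_simp
      ring
  · refine ((key _ (H.integrable_shift x)).neg).congr (Eventually.of_forall fun u => ?_)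
    simp [div_neg]
  · refine (key _ (H.integrable_shift x).comp_neg).congr (Eventually.of_forall fun u => ?_)
    simp

lemma integrable_cauchy (H : LipschitzAwayFrom h P K M) {z : ℂ} (hz : 0 < z.im) :
    Integrable (fun s : ℝ => (h s : ℂ) / ((s : ℂ) - z)) := by
  have hne : ∀ s : ℝ, (s : ℂ) - z ≠ 0 := fun s hs => by
    have := congrArg Complex.im hs
    simp at this
    exact hz.ne' this
  refine H.integrable.ofReal.mul_bdd (g := fun s : ℝ => ((s : ℂ) - z)⁻¹) (c := z.im⁻¹) ?_ ?_
  · refine Continuous.aestronglyMeasurable (Continuous.inv₀ (by fun_prop) hne)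
  · refine Eventually.of_forall fun s => ?_
    rw [norm_inv]
    refine inv_anti₀ hz ?_
    have := Complex.abs_im_le_norm ((s : ℂ) - z)
    simp [abs_of_pos hz] at this
    exact this

lemma kernel_re (a s x y : ℝ) :
    ((a : ℂ) / ((s : ℂ) - (x + y * I))).re = a * ((s - x) / ((s - x) ^ 2 + y ^ 2)) := by
  simp [Complex.div_re, Complex.normSq_apply, pow_two]
  ring

lemma kernel_im (a s x y : ℝ) :
    ((a : ℂ) / ((s : ℂ) - (x + y * I))).im = a * (y / ((s - x) ^ 2 + y ^ 2)) := by
  simp [Complex.div_im, Complex.normSq_apply, pow_two]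
  ring

lemma integrable_re_cauchy (H : LipschitzAwayFrom h P K M) (x : ℝ) {y : ℝ} (hy : 0 < y) :
    Integrable (fun s => h s * ((s - x) / ((s - x) ^ 2 + y ^ 2))) := by
  refine (H.integrable_cauchy (z := x + y * I) (by simpa using hy)).re.congr
    (Eventually.of_forall fun s => ?_)
  exact kernel_re _ _ _ _

lemma re_cauchyTransform_eq_integral (H : LipschitzAwayFrom h P K M) (x : ℝ) {y : ℝ}
    (hy : 0 < y) : (cauchyTransform h (x + y * I)).re
      = ∫ s, h s * ((s - x) / ((s - x) ^ 2 + y ^ 2)) := by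
  rw [cauchyTransform]
  refine (integral_re (H.integrable_cauchy (z := x + y * I) (by simpa using hy))).symm.trans
    (integral_congr_ae (Eventually.of_forall fun s => ?_))
  exact kernel_re _ _ _ _

lemma re_cauchyTransform (H : LipschitzAwayFrom h P K M) (x : ℝ) {y : ℝ} (hy : 0 < y) :
    (cauchyTransform h (x + y * I)).re
      = ∫ u in Ioi 0, (h (x + u) - h (x - u)) * (u / (u ^ 2 + y ^ 2)) := by
  rw [H.re_cauchyTransform_eq_integral x hy, ← integral_add_left_eq_self _ x,
    integral_eq_setIntegral_Ioi ((H.integrable_re_cauchy x hy).comp_add_left x)]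
  refine integral_congr_ae (Eventually.of_forall fun u => ?_)
  simp [← sub_eq_add_neg]
  ring

lemma im_cauchyTransform (H : LipschitzAwayFrom h P K M) (x : ℝ) {y : ℝ} (hy : 0 < y) :
    (cauchyTransform h (x + y * I)).im = ∫ t, h (x + y * t) * (1 + t ^ 2)⁻¹ := by
  have hI := H.integrable_cauchy (z := x + y * I) (by simpa using hy)
  have h0 : (cauchyTransform h (x + y * I)).im
      = ∫ s, h s * (y / ((s - x) ^ 2 + y ^ 2)) := by
    rw [cauchyTransform]
    refine (integral_im hI).symm.trans (integral_congr_ae (Eventually.of_forall fun s => ?_))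
    exact kernel_im _ _ _ _
  have h2 := Measure.integral_comp_mul_left
    (fun u => h (x + u) * (y / ((x + u - x) ^ 2 + y ^ 2))) y
  rw [h0, ← integral_add_left_eq_self _ x]
  rw [abs_of_pos (by positivity), smul_eq_mul, inv_mul_eq_div, eq_div_iff hy.ne'] at h2
  rw [← h2, ← integral_mul_const]
  refine integral_congr_ae (Eventually.of_forall fun u => ?_)
  simp only [add_sub_cancel_left]
  field_simp
  ring

end LipschitzAwayFrom

/-- An integrable majorant of `u ↦ |h (x + u) - h (x - u)| / u` on the positive half-line, where
`d` is the distance from `x` to the exceptional set. -/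
noncomputable def differenceMajorant (K M d R u : ℝ) : ℝ :=
  (Ioo 0 d).indicator (fun _ => 2 * K) u + (Icc d R).indicator (fun u => M * u⁻¹) u

lemma integrable_differenceMajorant {K M d R : ℝ} (hd : 0 < d) :
    Integrable (differenceMajorant K M d R) := by
  refine Integrable.add ?_ ?_
  · rw [integrable_indicator_iff measurableSet_Ioo]
    exact integrableOn_const (by simp)
  · rw [integrable_indicator_iff measurableSet_Icc]
    refine ContinuousOn.integrableOn_Icc fun u hu => ?_
    have : u ≠ 0 := (hd.trans_le hu.1).ne'
    exact (continuousAt_const.mul (continuousAt_inv₀ this)).continuousWithinAt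

lemma setIntegral_differenceMajorant {K M d R : ℝ} (hd : 0 < d) (hR : d ≤ R) :
    ∫ u in Ioi 0, differenceMajorant K M d R u = 2 * K * d + M * Real.log (R / d) := by
  have h1 : Ioi (0 : ℝ) ∩ Ioo 0 d = Ioo 0 d := by
    ext u; simp
  have h2 : Ioi (0 : ℝ) ∩ Icc d R = Icc d R :=
    inter_eq_self_of_subset_right fun u hu => hd.trans_le hu.1
  have hi : IntegrableOn (fun u => (Ioo 0 d).indicator (fun _ => 2 * K) u) (Ioi 0) := by
    refine Integrable.integrableOn ?_
    rw [integrable_indicator_iff measurableSet_Ioo]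
    exact integrableOn_const (by simp)
  have hj : IntegrableOn (fun u => (Icc d R).indicator (fun u => M * u⁻¹) u) (Ioi 0) := by
    refine (((integrable_differenceMajorant (K := K) (M := M) (R := R) hd).integrableOn).sub
      hi).congr (Eventually.of_forall fun u => ?_)
    simp [differenceMajorant]
  simp only [differenceMajorant]
  rw [integral_add hi hj, setIntegral_indicator measurableSet_Ioo, h1,
    setIntegral_indicator measurableSet_Icc, h2, integral_Icc_eq_integral_Ioc,
    ← intervalIntegral.integral_of_le hR, intervalIntegral.integral_const_mul,
    integral_inv_of_pos hd (hd.trans_le hR)]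
  simp [hd.le]
  ring

namespace LipschitzAwayFrom

variable {h : ℝ → ℝ} {P : Finset ℝ} {K M : ℝ}

lemma abs_difference_le (H : LipschitzAwayFrom h P K M) {x d R u : ℝ}
    (hd : ∀ p ∈ P, d ≤ |x - p|) (hR : |x| + 1 ≤ R) (hu : 0 < u) :
    |h (x + u) - h (x - u)| ≤ u * differenceMajorant K M d R u := by
  have hx1 := neg_abs_le x
  have hx2 := le_abs_self x
  rcases lt_or_ge u d with hud | hud
  · have e : differenceMajorant K M d R u = 2 * K := by
      simp [differenceMajorant, hu, hud, not_le.2 hud]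
    have h1 := H.lip x d hd (x + u) (by simpa [abs_of_pos hu] using hud)
    have h2 := H.lip x d hd (x - u) (by simpa [abs_of_pos hu] using hud)
    rw [show x + u - x = u by ring, abs_of_pos hu] at h1
    rw [show x - u - x = -u by ring, abs_neg, abs_of_pos hu] at h2
    rw [e]
    calc |h (x + u) - h (x - u)| = |(h (x + u) - h x) - (h (x - u) - h x)| := by ring_nf
      _ ≤ |h (x + u) - h x| + |h (x - u) - h x| := abs_sub _ _
      _ ≤ u * (2 * K) := by linarith
  · rcases le_or_gt u R with huR | huR
    · have e : differenceMajorant K M d R u = M * u⁻¹ := by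
        simp [differenceMajorant, not_lt.2 hud, hud, huR]
      rw [e, show u * (M * u⁻¹) = M by field_simp]
      exact H.osc _ _
    · have e : differenceMajorant K M d R u = 0 := by
        simp [differenceMajorant, not_lt.2 hud, not_le.2 huR]
      rw [e, H.zero (x + u), H.zero (x - u)]
      · simp
      · intro hm
        linarith [hm.1]
      · intro hm
        linarith [hm.2]

lemma abs_difference_div_le (H : LipschitzAwayFrom h P K M) {x d R u : ℝ}
    (hd : ∀ p ∈ P, d ≤ |x - p|) (hR : |x| + 1 ≤ R) (hu : 0 < u) :
    |(h (x + u) - h (x - u)) / u| ≤ differenceMajorant K M d R u := by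
  rw [abs_div, abs_of_pos hu, div_le_iff₀ hu, mul_comm]
  exact H.abs_difference_le hd hR hu

lemma abs_difference_mul_le (H : LipschitzAwayFrom h P K M) {x d R u y : ℝ}
    (hd : ∀ p ∈ P, d ≤ |x - p|) (hR : |x| + 1 ≤ R) (hu : 0 < u) :
    |(h (x + u) - h (x - u)) * (u / (u ^ 2 + y ^ 2))| ≤ differenceMajorant K M d R u := by
  refine le_trans ?_ (H.abs_difference_div_le hd hR hu)
  rw [abs_mul, abs_div _ u, div_eq_mul_inv]
  refine mul_le_mul_of_nonneg_left ?_ (abs_nonneg _)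
  rw [abs_of_pos (by positivity), abs_of_pos hu, ← div_eq_mul_inv, ← one_div,
    div_le_div_iff₀ (by positivity) hu]
  nlinarith [sq_nonneg y]

lemma aestronglyMeasurable_difference (H : LipschitzAwayFrom h P K M) (x : ℝ) :
    AEStronglyMeasurable (fun u => h (x + u) - h (x - u)) (volume.restrict (Ioi 0)) :=
  ((H.integrable.comp_add_left x).sub
    (H.integrable.comp_sub_left x)).aestronglyMeasurable.restrict

lemma integrableOn_difference_div (H : LipschitzAwayFrom h P K M) {x : ℝ} (hx : x ∉ P) :
    IntegrableOn (fun u => (h (x + u) - h (x - u)) / u) (Ioi 0) := by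
  obtain ⟨p, -, hpos, hmin⟩ := H.exists_nearest hx
  refine (integrable_differenceMajorant (K := K) (M := M) (R := |x| + 1) hpos).integrableOn.mono'
    ((H.aestronglyMeasurable_difference x).mul
      measurable_inv.aestronglyMeasurable) ?_
  filter_upwards [ae_restrict_mem measurableSet_Ioi] with u hu
  exact H.abs_difference_div_le hmin le_rfl hu

/-- The principal value integral, folded onto the positive half-line. -/
lemma HT_eq (H : LipschitzAwayFrom h P K M) {x : ℝ} (hx : x ∉ P) :
    HT h x = (1 / π) * ∫ u in Ioi 0, (h (x + u) - h (x - u)) / u := by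
  refine Tendsto.limUnder_eq ?_
  have hI := H.integrableOn_difference_div hx
  have h1 : Tendsto (fun ε : ℝ => ∫ u in Ioi ε, (h (x + u) - h (x - u)) / u) (𝓝[>] 0)
      (𝓝 (∫ u in Ioi 0, (h (x + u) - h (x - u)) / u)) := by
    have h2 : ∀ ε : ℝ, 0 < ε → ∫ u in Ioi ε, (h (x + u) - h (x - u)) / u
        = ∫ u in Ioi 0, (Ioi ε).indicator (fun u => (h (x + u) - h (x - u)) / u) u := by
      intro ε hε
      rw [setIntegral_indicator measurableSet_Ioi,
        inter_eq_self_of_subset_right (Ioi_subset_Ioi hε.le)]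
    refine Tendsto.congr' (f₁ := fun ε : ℝ =>
      ∫ u in Ioi 0, (Ioi ε).indicator (fun u => (h (x + u) - h (x - u)) / u) u) ?_ ?_
    · filter_upwards [self_mem_nhdsWithin] with ε hε
      exact (h2 ε hε).symm
    · refine tendsto_integral_filter_of_dominated_convergence
        (fun u => ‖(h (x + u) - h (x - u)) / u‖) ?_ ?_ hI.norm ?_
      · exact Eventually.of_forall fun ε => hI.aestronglyMeasurable.indicator measurableSet_Ioi
      · exact Eventually.of_forall fun ε => Eventually.of_forall fun u =>
          norm_indicator_le_norm_self _ _
      · filter_upwards [ae_restrict_mem measurableSet_Ioi] with u hu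
        refine tendsto_const_nhds.congr' ?_
        filter_upwards [mem_nhdsWithin_of_mem_nhds (Iio_mem_nhds hu)] with ε hε
        exact (indicator_of_mem (mem_Ioi.2 hε) _).symm
  refine (h1.const_mul (1 / π)).congr' ?_
  filter_upwards [self_mem_nhdsWithin] with ε hε
  rw [H.truncated_integral_eq x hε]
  ring

lemma tendsto_re_cauchyTransform (H : LipschitzAwayFrom h P K M) {x : ℝ} (hx : x ∉ P) :
    Tendsto (fun y : ℝ => (cauchyTransform h (x + y * I)).re) (𝓝[>] 0) (𝓝 (π * HT h x)) := by
  obtain ⟨p, -, hpos, hmin⟩ := H.exists_nearest hx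
  rw [H.HT_eq hx, ← mul_assoc, mul_one_div_cancel Real.pi_ne_zero, one_mul]
  refine Tendsto.congr' (f₁ := fun y : ℝ =>
    ∫ u in Ioi 0, (h (x + u) - h (x - u)) * (u / (u ^ 2 + y ^ 2))) ?_ ?_
  · filter_upwards [self_mem_nhdsWithin] with y hy
    exact (H.re_cauchyTransform x hy).symm
  · refine tendsto_integral_filter_of_dominated_convergence
      (differenceMajorant K M |x - p| (|x| + 1)) ?_ ?_
      (integrable_differenceMajorant hpos).integrableOn ?_
    · refine Eventually.of_forall fun y => (H.aestronglyMeasurable_difference x).mul ?_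
      exact (by fun_prop : Measurable fun u : ℝ => u / (u ^ 2 + y ^ 2)).aestronglyMeasurable
    · refine Eventually.of_forall fun y => ?_
      filter_upwards [ae_restrict_mem measurableSet_Ioi] with u hu
      exact H.abs_difference_mul_le hmin le_rfl hu
    · filter_upwards [ae_restrict_mem measurableSet_Ioi] with u hu
      have hu' : u ≠ 0 := (mem_Ioi.1 hu).ne'
      have hc : ContinuousAt (fun y : ℝ =>
          (h (x + u) - h (x - u)) * (u / (u ^ 2 + y ^ 2))) 0 := by
        refine continuousAt_const.mul (continuousAt_const.div (by fun_prop) ?_)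
        positivity
      have := hc.tendsto
      rw [show (h (x + u) - h (x - u)) * (u / (u ^ 2 + 0 ^ 2))
        = (h (x + u) - h (x - u)) / u by field_simp; ring] at this
      exact this.mono_left nhdsWithin_le_nhds

lemma tendsto_im_cauchyTransform (H : LipschitzAwayFrom h P K M) {x : ℝ} (hx : x ∉ P) :
    Tendsto (fun y : ℝ => (cauchyTransform h (x + y * I)).im) (𝓝[>] 0) (𝓝 (π * h x)) := by
  have e : π * h x = ∫ t : ℝ, h x * (1 + t ^ 2)⁻¹ := by
    rw [integral_const_mul, integral_univ_inv_one_add_sq, mul_comm]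
  rw [e]
  refine Tendsto.congr' (f₁ := fun y : ℝ => ∫ t, h (x + y * t) * (1 + t ^ 2)⁻¹) ?_ ?_
  · filter_upwards [self_mem_nhdsWithin] with y hy
    exact (H.im_cauchyTransform x hy).symm
  · refine tendsto_integral_filter_of_dominated_convergence
      (fun t => M * (1 + t ^ 2)⁻¹) ?_ ?_ (integrable_inv_one_add_sq.const_mul M) ?_
    · filter_upwards [self_mem_nhdsWithin] with y hy
      exact ((H.integrable.comp_add_left x).comp_mul_left'
        (mem_Ioi.1 hy).ne').aestronglyMeasurable.mul
        (by fun_prop : Measurable fun t : ℝ => (1 + t ^ 2)⁻¹).aestronglyMeasurable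
    · refine Eventually.of_forall fun y => Eventually.of_forall fun t => ?_
      rw [norm_mul, Real.norm_eq_abs, Real.norm_eq_abs, abs_of_pos (a := (1 + t ^ 2)⁻¹)
        (by positivity)]
      exact mul_le_mul_of_nonneg_right (H.abs_le _) (by positivity)
    · refine Eventually.of_forall fun t => Tendsto.mul_const _ ?_
      have h1 : Tendsto (fun y : ℝ => x + y * t) (𝓝[>] 0) (𝓝 x) := by
        have : Continuous fun y : ℝ => x + y * t := by fun_prop
        simpa using (this.tendsto 0).mono_left nhdsWithin_le_nhds
      exact (H.continuousAt hx).tendsto.comp h1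

lemma abs_re_cauchyTransform_le (H : LipschitzAwayFrom h P K M) {x d R y : ℝ}
    (hd0 : 0 < d) (hd : ∀ p ∈ P, d ≤ |x - p|) (hR : |x| + 1 ≤ R) (hy : 0 < y) :
    |(cauchyTransform h (x + y * I)).re| ≤ 2 * K * d + M * Real.log (R / d) := by
  have hdR : d ≤ R := by
    refine (hd 1 H.one_mem).trans (le_trans ?_ hR)
    simpa using abs_sub x 1
  rw [H.re_cauchyTransform x hy, ← setIntegral_differenceMajorant hd0 hdR, ← Real.norm_eq_abs]
  refine norm_integral_le_of_norm_le (integrable_differenceMajorant hd0).integrableOn ?_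
  filter_upwards [ae_restrict_mem measurableSet_Ioi] with u hu
  exact H.abs_difference_mul_le hd hR hu

/-- Pointwise bound for the exponential of a Cauchy transform, uniform in the height. -/
lemma exp_abs_re_cauchyTransform_le (H : LipschitzAwayFrom h P K M) {x R y : ℝ}
    (hx : x ∉ P) (hR : |x| + 1 ≤ R) (hy : 0 < y) :
    Real.exp (|(cauchyTransform h (x + y * I)).re| / π)
      ≤ Real.exp (2 * K * R / π) * R ^ (M / π) * ∑ p ∈ P, |x - p| ^ (-(M / π)) := by
  obtain ⟨p, hp, hpos, hmin⟩ := H.exists_nearest hx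
  have hdR : |x - p| ≤ R := by
    refine (hmin 1 H.one_mem).trans (le_trans ?_ hR)
    simpa using abs_sub x 1
  have hR0 : 0 < R := hpos.trans_le hdR
  have h1 := H.abs_re_cauchyTransform_le hpos hmin hR hy
  have h2 : |(cauchyTransform h (x + y * I)).re| / π
      ≤ 2 * K * R / π + Real.log (R / |x - p|) * (M / π) := by
    rw [mul_div_assoc', ← add_div]
    refine div_le_div_of_nonneg_right ?_ Real.pi_pos.le
    nlinarith [mul_le_mul_of_nonneg_left hdR H.nonneg]
  calc Real.exp (|(cauchyTransform h (x + y * I)).re| / π)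
      ≤ Real.exp (2 * K * R / π + Real.log (R / |x - p|) * (M / π)) := Real.exp_le_exp.2 h2
    _ = Real.exp (2 * K * R / π) * R ^ (M / π) * |x - p| ^ (-(M / π)) := by
      rw [Real.exp_add, ← Real.rpow_def_of_pos (by positivity), Real.div_rpow hR0.le hpos.le,
        Real.rpow_neg hpos.le]
      ring
    _ ≤ _ := by
      refine mul_le_mul_of_nonneg_left ?_ (by positivity)
      exact Finset.single_le_sum (f := fun p => |x - p| ^ (-(M / π)))
        (fun q _ => by positivity) hp

lemma differentiableAt_cauchyTransform (H : LipschitzAwayFrom h P K M) {z : ℂ} (hz : 0 < z.im) :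
    DifferentiableAt ℂ (cauchyTransform h) z := by
  have hs : {w : ℂ | z.im / 2 < w.im} ∈ 𝓝 z :=
    (isOpen_lt continuous_const Complex.continuous_im).mem_nhds (by simpa using hz)
  have hle : ∀ w ∈ {w : ℂ | z.im / 2 < w.im}, ∀ s : ℝ, z.im / 2 ≤ ‖(s : ℂ) - w‖ := by
    intro w hw s
    have h1 : z.im / 2 < w.im := hw
    have := Complex.abs_im_le_norm ((s : ℂ) - w)
    simp only [sub_im, ofReal_im, zero_sub, abs_neg] at this
    linarith [le_abs_self w.im]
  have hne : ∀ w ∈ {w : ℂ | z.im / 2 < w.im}, ∀ s : ℝ, (s : ℂ) - w ≠ 0 := fun w hw s =>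
    norm_pos_iff.1 ((half_pos hz).trans_le (hle w hw s))
  have hz' := mem_of_mem_nhds hs
  refine (hasDerivAt_integral_of_dominated_loc_of_deriv_le
    (F := fun w (s : ℝ) => (h s : ℂ) / ((s : ℂ) - w))
    (F' := fun w (s : ℝ) => (h s : ℂ) * (((s : ℂ) - w) ^ 2)⁻¹)
    (bound := fun s => |h s| * ((z.im / 2) ^ 2)⁻¹) hs ?_ (H.integrable_cauchy hz) ?_ ?_ ?_
    ?_).2.differentiableAt
  · filter_upwards [hs] with w hw
    exact (H.integrable_cauchy ((half_pos hz).trans hw)).aestronglyMeasurable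
  · refine H.integrable.ofReal.aestronglyMeasurable.mul
      (Continuous.aestronglyMeasurable (Continuous.inv₀ (by fun_prop) fun s => ?_))
    exact pow_ne_zero 2 (hne z hz' s)
  · refine Eventually.of_forall fun s w hw => ?_
    rw [norm_mul, norm_inv, norm_pow, Complex.norm_real, Real.norm_eq_abs]
    refine mul_le_mul_of_nonneg_left (inv_anti₀ (by positivity) ?_) (abs_nonneg _)
    exact pow_le_pow_left₀ (by positivity) (hle w hw s) 2
  · exact H.integrable.abs.mul_const _
  · refine Eventually.of_forall fun s w hw => ?_
    have h1 := ((hasDerivAt_id w).const_sub (s : ℂ)).inv (hne w hw s)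
    have h2 := h1.const_mul (h s : ℂ)
    simpa [div_eq_mul_inv] using h2

end LipschitzAwayFrom

section Green

variable {F : ℂ → ℂ} {φ : ℝ × ℝ → ℝ}

/-- The integrand `F · (∂φ/∂x + i ∂φ/∂y)`, i.e. twice the `∂̄`-derivative of `F φ`. -/
noncomputable def dbarIntegrand (F : ℂ → ℂ) (φ : ℝ × ℝ → ℝ) (q : ℝ × ℝ) : ℂ :=
  F ((q.1 : ℂ) + (q.2 : ℂ) * I)
    * ((fderiv ℝ φ q (1, 0) : ℂ) + (fderiv ℝ φ q (0, 1) : ℂ) * I)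

lemma dbarIntegrand_re (q : ℝ × ℝ) : (dbarIntegrand F φ q).re =
    (F ((q.1 : ℂ) + (q.2 : ℂ) * I)).re * fderiv ℝ φ q (1, 0)
      - (F ((q.1 : ℂ) + (q.2 : ℂ) * I)).im * fderiv ℝ φ q (0, 1) := by
  simp [dbarIntegrand]

lemma hasFDerivAt_mul_test (hF : ∀ z : ℂ, 0 < z.im → DifferentiableAt ℂ F z)
    (hφ : ContDiff ℝ (⊤ : ℕ∞) φ) {q : ℝ × ℝ} (hq : 0 < q.2) :
    ∃ L : ℝ × ℝ →L[ℝ] ℂ,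
      HasFDerivAt (fun q : ℝ × ℝ => F ((q.1 : ℂ) + (q.2 : ℂ) * I) * (φ q : ℂ)) L q ∧
        L (1, 0) + I * L (0, 1) = dbarIntegrand F φ q := by
  have h1 : HasFDerivAt (fun q : ℝ × ℝ => (q.1 : ℂ) + (q.2 : ℂ) * I)
      (Complex.equivRealProdCLM.symm : ℝ × ℝ →L[ℝ] ℂ) q := by
    refine (Complex.equivRealProdCLM.symm : ℝ × ℝ →L[ℝ] ℂ).hasFDerivAt.congr_of_eventuallyEq
      (Eventually.of_forall fun p => ?_)
    simp [Complex.equivRealProdCLM_symm_apply]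
  have h2 := (hF ((q.1 : ℂ) + (q.2 : ℂ) * I) (by simpa using hq)).hasDerivAt.complexToReal_fderiv
  have h3 := h2.comp q h1
  have h4 : HasFDerivAt φ (fderiv ℝ φ q) q :=
    (hφ.differentiable (by simp) q).hasFDerivAt
  have h5 := Complex.ofRealCLM.hasFDerivAt.comp q h4
  refine ⟨_, h3.mul h5, ?_⟩
  simp [dbarIntegrand, Complex.equivRealProdCLM_symm_apply]
  ring_nf
  simp
  ring

lemma continuousOn_dbarIntegrand (hF : ∀ z : ℂ, 0 < z.im → DifferentiableAt ℂ F z)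
    (hφ : ContDiff ℝ (⊤ : ℕ∞) φ) : ContinuousOn (dbarIntegrand F φ) {q : ℝ × ℝ | 0 < q.2} := by
  have hd : Continuous (fderiv ℝ φ) := hφ.continuous_fderiv (by simp)
  have h1 : ContinuousOn (fun q : ℝ × ℝ => F ((q.1 : ℂ) + (q.2 : ℂ) * I))
      {q : ℝ × ℝ | 0 < q.2} := by
    have hF' : ContinuousOn F {z : ℂ | 0 < z.im} :=
      fun z hz => (hF z hz).continuousAt.continuousWithinAt
    refine hF'.comp (Continuous.continuousOn (by fun_prop)) fun q hq => ?_
    simpa using hq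
  refine h1.mul (Continuous.continuousOn ?_)
  fun_prop

/-- Green's formula on the upper half-plane for a holomorphic function whose imaginary part
has boundary values, under an integrable bound that does not depend on the height. -/
lemma setIntegral_dbarIntegrand_re (hF : ∀ z : ℂ, 0 < z.im → DifferentiableAt ℂ F z)
    (hφ : ContDiff ℝ (⊤ : ℕ∞) φ) (hsupp : HasCompactSupport φ)
    (hbound : ∀ R : ℝ, 0 < R → ∃ b : ℝ → ℝ, IntegrableOn b (Icc (-R) R) ∧
      ∀ᵐ x : ℝ, |x| ≤ R → ∀ y : ℝ, 0 < y → ‖F (x + y * I)‖ ≤ b x)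
    {v : ℝ → ℝ} (hv : ∀ᵐ x : ℝ, Tendsto (fun y : ℝ => (F (x + y * I)).im) (𝓝[>] 0) (𝓝 (v x))) :
    ∫ q in {q : ℝ × ℝ | 0 < q.2}, (dbarIntegrand F φ q).re = ∫ x, v x * φ (x, 0) := by
  obtain ⟨R, hR0, hR⟩ : ∃ R : ℝ, 0 < R ∧ ∀ q : ℝ × ℝ, R ≤ ‖q‖ → q ∉ tsupport φ := by
    obtain ⟨R, hR0, hR⟩ := hsupp.isCompact.isBounded.subset_ball_lt 0 0
    refine ⟨R, hR0, fun q hq hq' => ?_⟩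
    have := hR hq'
    simp at this
    exact absurd this (not_lt.2 hq)
  have hφ0 : ∀ q : ℝ × ℝ, R ≤ ‖q‖ → φ q = 0 := fun q hq =>
    image_eq_zero_of_notMem_tsupport (hR q hq)
  have hN0 : ∀ q : ℝ × ℝ, R ≤ ‖q‖ → dbarIntegrand F φ q = 0 := by
    intro q hq
    have : fderiv ℝ φ q = 0 :=
      Function.notMem_support.1 fun hs => hR q hq (support_fderiv_subset ℝ hs)
    simp [dbarIntegrand, this]
  have hR1 : ∀ x : ℝ × ℝ, R ≤ |x.1| → R ≤ ‖x‖ := fun x hx =>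
    hx.trans (by simpa using norm_fst_le x)
  have hR2 : ∀ x : ℝ × ℝ, R ≤ |x.2| → R ≤ ‖x‖ := fun x hx =>
    hx.trans (by simpa using norm_snd_le x)
  obtain ⟨b, hb, hFb⟩ := hbound R hR0
  have hUm : MeasurableSet {q : ℝ × ℝ | 0 < q.2} :=
    measurableSet_lt measurable_const measurable_snd
  have hcont := continuousOn_dbarIntegrand hF hφ
  have hNint : IntegrableOn (dbarIntegrand F φ) {q : ℝ × ℝ | 0 < q.2} := by
    obtain ⟨C, hC⟩ : ∃ C, ∀ q, ‖fderiv ℝ φ q‖ ≤ C := by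
      obtain ⟨C, hC⟩ := (hφ.continuous_fderiv (by simp)).bounded_above_of_compact_support
        (hsupp.fderiv ℝ)
      exact ⟨C, hC⟩
    have hmaj : Integrable (fun q : ℝ × ℝ => (Icc (-R) R).indicator b q.1
        * (Icc (-R) R).indicator (fun _ => 2 * C) q.2) := by
      refine Integrable.mul_prod (f := (Icc (-R) R).indicator b)
        (g := (Icc (-R) R).indicator (fun _ => 2 * C)) ?_ ?_
      · exact (integrable_indicator_iff measurableSet_Icc).2 hb
      · exact (integrable_indicator_iff measurableSet_Icc).2 (integrableOn_const (by simp))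
    refine hmaj.integrableOn.mono' (hcont.aestronglyMeasurable hUm) ?_
    have hFb' : ∀ᵐ q : ℝ × ℝ, |q.1| ≤ R → ∀ y : ℝ, 0 < y → ‖F (q.1 + y * I)‖ ≤ b q.1 :=
      Measure.quasiMeasurePreserving_fst.ae hFb
    filter_upwards [ae_restrict_mem hUm, ae_restrict_of_ae hFb'] with q hq hqb
    rcases lt_or_ge ‖q‖ R with hqR | hqR
    · have hq1 : |q.1| ≤ R := by simpa using (norm_fst_le q).trans hqR.le
      have hq2 : |q.2| ≤ R := by simpa using (norm_snd_le q).trans hqR.le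
      rw [indicator_of_mem (mem_Icc.2 (_root_.abs_le.1 hq1)),
        indicator_of_mem (mem_Icc.2 (_root_.abs_le.1 hq2)),
        dbarIntegrand, norm_mul]
      refine mul_le_mul (hqb hq1 _ hq) ?_ (norm_nonneg _)
        ((norm_nonneg _).trans (hqb hq1 _ hq))
      have e1 : |fderiv ℝ φ q (1, 0)| ≤ C := by
        refine (((fderiv ℝ φ q).le_opNorm (1, 0)).trans ?_)
        simpa [Prod.norm_def] using hC q
      have e2 : |fderiv ℝ φ q (0, 1)| ≤ C := by
        refine (((fderiv ℝ φ q).le_opNorm (0, 1)).trans ?_)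
        simpa [Prod.norm_def] using hC q
      refine (norm_add_le _ _).trans ?_
      rw [norm_mul, Complex.norm_I, mul_one, Complex.norm_real, Complex.norm_real,
        Real.norm_eq_abs, Real.norm_eq_abs]
      linarith
    · rw [hN0 q hqR, norm_zero, indicator_apply, indicator_apply]
      split_ifs with h1 h2
      · exact mul_nonneg ((norm_nonneg _).trans (hqb (_root_.abs_le.2 h1) 1 one_pos))
          (by linarith [(norm_nonneg _).trans (hC q)])
      all_goals simp
  have hlim1 : Tendsto (fun ε : ℝ => ∫ q in Icc ((-R, ε) : ℝ × ℝ) (R, R), dbarIntegrand F φ q)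
      (𝓝[>] 0) (𝓝 (∫ q in {q : ℝ × ℝ | 0 < q.2}, dbarIntegrand F φ q)) := by
    refine Tendsto.congr' (f₁ := fun ε : ℝ => ∫ q in {q : ℝ × ℝ | 0 < q.2},
      (Icc ((-R, ε) : ℝ × ℝ) (R, R)).indicator (dbarIntegrand F φ) q) ?_ ?_
    · filter_upwards [self_mem_nhdsWithin] with ε hε
      rw [setIntegral_indicator measurableSet_Icc, inter_eq_self_of_subset_right]
      exact fun q hq => (mem_Ioi.1 hε).trans_le hq.1.2
    · refine tendsto_integral_filter_of_dominated_convergence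
        (fun q => ‖dbarIntegrand F φ q‖) ?_ ?_ hNint.norm ?_
      · exact Eventually.of_forall fun ε =>
          hNint.aestronglyMeasurable.indicator measurableSet_Icc
      · exact Eventually.of_forall fun ε => Eventually.of_forall fun u =>
          norm_indicator_le_norm_self _ _
      · filter_upwards [ae_restrict_mem hUm] with q hq
        refine tendsto_const_nhds.congr' ?_
        filter_upwards [mem_nhdsWithin_of_mem_nhds (Iio_mem_nhds hq)] with ε hε
        rcases lt_or_ge ‖q‖ R with hqR | hqR
        · have hq1 := _root_.abs_le.1 (by simpa using (norm_fst_le q).trans hqR.le : |q.1| ≤ R)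
          have hq2 := _root_.abs_le.1 (by simpa using (norm_snd_le q).trans hqR.le : |q.2| ≤ R)
          have hm : q ∈ Icc ((-R, ε) : ℝ × ℝ) (R, R) :=
            ⟨⟨hq1.1, le_of_lt hε⟩, ⟨hq1.2, hq2.2⟩⟩
          exact (indicator_of_mem hm _).symm
        · rw [indicator_apply, hN0 q hqR, ite_self]
  have hcontF : ContinuousOn (fun q : ℝ × ℝ => F ((q.1 : ℂ) + (q.2 : ℂ) * I) * (φ q : ℂ))
      {q : ℝ × ℝ | 0 < q.2} := fun q hq => by
    obtain ⟨L, hL, -⟩ := hasFDerivAt_mul_test hF hφ hq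
    exact hL.continuousAt.continuousWithinAt
  have hgreen : ∀ ε ∈ Ioo 0 R, (∫ q in Icc ((-R, ε) : ℝ × ℝ) (R, R), dbarIntegrand F φ q)
      = -∫ x in (-R)..R, I * (F ((x : ℂ) + (ε : ℂ) * I) * (φ (x, ε) : ℂ)) := by
    intro ε hε
    have hsub : Icc ((-R, ε) : ℝ × ℝ) (R, R) ⊆ {q : ℝ × ℝ | 0 < q.2} :=
      fun q hq => hε.1.trans_le hq.1.2
    have hex : ∀ q : ℝ × ℝ, ∃ L : ℝ × ℝ →L[ℝ] ℂ, 0 < q.2 →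
        (HasFDerivAt (fun q : ℝ × ℝ => F ((q.1 : ℂ) + (q.2 : ℂ) * I) * (φ q : ℂ)) L q ∧
          L (1, 0) + I * L (0, 1) = dbarIntegrand F φ q) := fun q => by
      by_cases hq : 0 < q.2
      · obtain ⟨L, hL⟩ := hasFDerivAt_mul_test hF hφ hq
        exact ⟨L, fun _ => hL⟩
      · exact ⟨0, fun h => absurd h hq⟩
    choose L hL using hex
    have hcongr : ∀ q ∈ Icc ((-R, ε) : ℝ × ℝ) (R, R),
        L q (1, 0) + (I • L q) (0, 1) = dbarIntegrand F φ q := fun q hq => by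
      simpa using (hL q (hsub hq)).2
    have := integral_divergence_prod_Icc_of_hasFDerivAt_of_le
      (fun q : ℝ × ℝ => F ((q.1 : ℂ) + (q.2 : ℂ) * I) * (φ q : ℂ))
      (fun q : ℝ × ℝ => I * (F ((q.1 : ℂ) + (q.2 : ℂ) * I) * (φ q : ℂ)))
      L (fun q => I • L q) (-R, ε) (R, R) ⟨by simpa using hR0.le, hε.2.le⟩
      (hcontF.mono hsub) (continuousOn_const.mul (hcontF.mono hsub))
      (fun q hq => (hL q (hε.1.trans hq.2.1)).1)
      (fun q hq => (hL q (hε.1.trans hq.2.1)).1.const_mul I)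
      ((hNint.mono_set hsub).congr_fun (fun q hq => (hcongr q hq).symm) measurableSet_Icc)
    rw [setIntegral_congr_fun measurableSet_Icc hcongr] at this
    rw [this]
    have z1 : ∀ x : ℝ, φ (x, R) = 0 := fun x => hφ0 _ (hR2 (x, R) (le_abs_self R))
    have z2 : ∀ y : ℝ, φ (R, y) = 0 := fun y => hφ0 _ (hR1 (R, y) (le_abs_self R))
    have z3 : ∀ y : ℝ, φ (-R, y) = 0 := fun y => hφ0 _ (hR1 (-R, y)
      (by simpa using le_abs_self R))
    simp [z1, z2, z3]
  have hslice : ∀ ε : ℝ, 0 < ε → Continuous fun x : ℝ =>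
      F ((x : ℂ) + (ε : ℂ) * I) * (φ (x, ε) : ℂ) := fun ε hε =>
    hcontF.comp_continuous (f := fun x : ℝ => ((x, ε) : ℝ × ℝ)) (by fun_prop) fun _ => hε
  have hre : ∀ ε ∈ Ioo 0 R, (∫ q in Icc ((-R, ε) : ℝ × ℝ) (R, R), dbarIntegrand F φ q).re
      = ∫ x in Ioc (-R) R, (F ((x : ℂ) + (ε : ℂ) * I)).im * φ (x, ε) := by
    intro ε hε
    rw [hgreen ε hε, intervalIntegral.integral_of_le (by linarith), ← integral_neg]
    have hi : IntegrableOn (fun x : ℝ => -(I * (F ((x : ℂ) + (ε : ℂ) * I) * (φ (x, ε) : ℂ))))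
        (Ioc (-R) R) :=
      ((continuous_const.mul (hslice ε hε.1)).neg.integrableOn_Icc).mono_set Ioc_subset_Icc_self
    refine (integral_re hi).symm.trans (integral_congr_ae (Eventually.of_forall fun x => ?_))
    simp
  have hlim2 : Tendsto (fun ε : ℝ =>
      ∫ x in Ioc (-R) R, (F ((x : ℂ) + (ε : ℂ) * I)).im * φ (x, ε)) (𝓝[>] 0)
      (𝓝 (∫ x in Ioc (-R) R, v x * φ (x, 0))) := by
    obtain ⟨C, hC⟩ := hφ.continuous.bounded_above_of_compact_support hsupp
    refine tendsto_integral_filter_of_dominated_convergence (fun x => b x * C) ?_ ?_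
      ((hb.mono_set Ioc_subset_Icc_self).mul_const C) ?_
    · filter_upwards [self_mem_nhdsWithin] with ε hε
      refine (Complex.continuous_im.comp (hslice ε hε)).aestronglyMeasurable.congr
        (Eventually.of_forall fun x => ?_)
      simp
    · filter_upwards [self_mem_nhdsWithin] with ε hε
      filter_upwards [ae_restrict_mem measurableSet_Ioc, ae_restrict_of_ae hFb] with x hx hxb
      have h1 := hxb (_root_.abs_le.2 ⟨hx.1.le, hx.2⟩) ε hε
      rw [norm_mul]
      exact mul_le_mul ((Complex.abs_im_le_norm _).trans h1) (hC _) (norm_nonneg _)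
        ((norm_nonneg _).trans h1)
    · filter_upwards [ae_restrict_of_ae hv] with x hx
      refine hx.mul ?_
      have hc : Continuous fun ε : ℝ => φ (x, ε) := hφ.continuous.comp (by fun_prop)
      exact (hc.tendsto 0).mono_left nhdsWithin_le_nhds
  have hlim3 := (Complex.continuous_re.tendsto _).comp hlim1
  have heq := tendsto_nhds_unique (hlim3.congr' (f₂ := fun ε : ℝ =>
      ∫ x in Ioc (-R) R, (F ((x : ℂ) + (ε : ℂ) * I)).im * φ (x, ε)) (by
    filter_upwards [Ioo_mem_nhdsGT hR0] with ε hε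
    exact hre ε hε)) hlim2
  refine (integral_re hNint).trans (heq.trans ?_)
  refine setIntegral_eq_integral_of_forall_compl_eq_zero fun x hx => ?_
  rw [hφ0 _ (hR1 (x, 0) ?_), mul_zero]
  by_contra! hlt
  exact hx ⟨(abs_lt.1 hlt).1, (abs_lt.1 hlt).2.le⟩

end Green

lemma integrableOn_abs_sub_rpow {r : ℝ} (hr : -1 < r) (p R : ℝ) :
    IntegrableOn (fun x => |x - p| ^ r) (Icc (-R) R) := by
  rcases lt_or_ge R (-R) with h | h
  · simp [Icc_eq_empty (not_le.2 h)]
  have h1 : IntervalIntegrable (fun x : ℝ => |x| ^ r) volume (-R - p) (R - p) := by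
    refine intervalIntegrable_of_even (fun x => by rw [abs_neg]) fun x hx => ?_
    refine (intervalIntegral.intervalIntegrable_rpow' hr (a := 0) (b := x)).congr ?_
    intro u hu
    rw [uIoc_of_le hx.le] at hu
    simp only [abs_of_pos hu.1]
  have h2 := h1.comp_sub_right p
  rw [sub_add_cancel, sub_add_cancel] at h2
  exact (intervalIntegrable_iff_integrableOn_Icc_of_le h).1 h2

namespace LipschitzAwayFrom

variable {h : ℝ → ℝ} {P : Finset ℝ} {K M : ℝ}

lemma tendsto_cauchyTransform (H : LipschitzAwayFrom h P K M) {x : ℝ} (hx : x ∉ P) :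
    Tendsto (fun y : ℝ => cauchyTransform h (x + y * I)) (𝓝[>] 0)
      (𝓝 (π * (HT h x + h x * I))) := by
  have h1 := (Complex.continuous_ofReal.tendsto _).comp (H.tendsto_re_cauchyTransform hx)
  have h2 := (Complex.continuous_ofReal.tendsto _).comp (H.tendsto_im_cauchyTransform hx)
  have h3 := h1.add (h2.mul_const I)
  rw [show (π : ℂ) * (HT h x + h x * I)
    = ((π * HT h x : ℝ) : ℂ) + ((π * h x : ℝ) : ℂ) * I by push_cast; ring]
  refine h3.congr fun y => ?_
  exact Complex.re_add_im _

lemma norm_exp_cauchyTransform_le (H : LipschitzAwayFrom h P K M) {x R y c : ℝ}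
    (hx : x ∉ P) (hR : |x| + 1 ≤ R) (hy : 0 < y) (hc : |c| = 1 / π) :
    ‖Complex.exp (c * cauchyTransform h (x + y * I))‖
      ≤ Real.exp (2 * K * R / π) * R ^ (M / π) * ∑ p ∈ P, |x - p| ^ (-(M / π)) := by
  refine le_trans ?_ (H.exp_abs_re_cauchyTransform_le hx hR hy)
  rw [Complex.norm_exp, Real.exp_le_exp, Complex.re_ofReal_mul]
  refine (le_abs_self _).trans ?_
  rw [abs_mul, hc, one_div_mul_eq_div]

end LipschitzAwayFrom

lemma abs_arctan_sub_le (a b : ℝ) : |Real.arctan a - Real.arctan b| ≤ |a - b| := by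
  have h : LipschitzWith 1 Real.arctan := by
    refine lipschitzWith_of_nnnorm_deriv_le Real.differentiable_arctan fun x => ?_
    rw [← NNReal.coe_le_coe, coe_nnnorm, Real.deriv_arctan, Real.norm_eq_abs,
      abs_of_pos (by positivity), NNReal.coe_one, div_le_one (by positivity)]
    nlinarith [sq_nonneg x]
  simpa [Real.dist_eq] using h.dist_le_mul a b

lemma exists_mem_Ico_of_chain {y : ℕ → ℝ} {x : ℝ} (h0 : y 0 ≤ x) :
    ∀ m, x < y m → ∃ j < m, y j ≤ x ∧ x < y (j + 1) := by
  intro m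
  induction m with
  | zero => exact fun h => absurd h (not_lt.2 h0)
  | succ m ih =>
    intro h
    rcases lt_or_ge x (y m) with hlt | hge
    · obtain ⟨j, hj, hj'⟩ := ih hlt
      exact ⟨j, hj.trans (Nat.lt_succ_self m), hj'⟩
    · exact ⟨m, Nat.lt_succ_self m, hge, h⟩

namespace PiecewiseLipschitzOn

variable {f : ℝ → ℝ}

lemma exists_bound (hf : PiecewiseLipschitzOn f) :
    ∃ B, ∀ s ∈ Ioo (-1 : ℝ) 1, |f s| ≤ B := by
  obtain ⟨m, y, -, h0, hm, hlt, hlip⟩ := hf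
  have hB : ∀ j, j < m → ∃ B, ∀ s ∈ Ioo (y j) (y (j + 1)), |f s| ≤ B := by
    intro j hj
    obtain ⟨K, hK⟩ := hlip j hj
    have hmid : (y j + y (j + 1)) / 2 ∈ Ioo (y j) (y (j + 1)) :=
      ⟨by linarith [hlt j hj], by linarith [hlt j hj]⟩
    refine ⟨|f ((y j + y (j + 1)) / 2)| + K * (y (j + 1) - y j), fun s hs => ?_⟩
    have h1 := hK.dist_le_mul s hs _ hmid
    rw [Real.dist_eq, Real.dist_eq] at h1
    have h2 : |s - (y j + y (j + 1)) / 2| ≤ y (j + 1) - y j :=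
      abs_le.2 ⟨by linarith [hs.1, hmid.2], by linarith [hs.2, hmid.1]⟩
    have h3 := abs_sub_abs_le_abs_sub (f s) (f ((y j + y (j + 1)) / 2))
    have h4 := mul_le_mul_of_nonneg_left h2 K.coe_nonneg
    linarith
  choose! B hB using hB
  have hB0 : ∀ j, j < m → 0 ≤ B j := fun j hj =>
    (abs_nonneg _).trans (hB j hj ((y j + y (j + 1)) / 2)
      ⟨by linarith [hlt j hj], by linarith [hlt j hj]⟩)
  refine ⟨∑ j ∈ Finset.range m, (B j + |f (y j)|), fun s hs => ?_⟩
  obtain ⟨j, hj, hj1, hj2⟩ := exists_mem_Ico_of_chain (h0.trans_le hs.1.le) m (hm ▸ hs.2)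
  have hle : B j + |f (y j)| ≤ ∑ j ∈ Finset.range m, (B j + |f (y j)|) :=
    Finset.single_le_sum (f := fun j => B j + |f (y j)|)
      (fun i hi => add_nonneg (hB0 i (Finset.mem_range.1 hi)) (abs_nonneg _))
      (Finset.mem_range.2 hj)
  rcases hj1.eq_or_lt with rfl | hlt'
  · linarith [hB0 j hj]
  · linarith [hB j hj s ⟨hlt', hj2⟩, abs_nonneg (f (y j))]

/-- The post-composition of a piecewise Lipschitz function with a contraction, extended by zero,
is Lipschitz away from a finite set that does not depend on the contraction. -/
lemma exists_lipschitzAwayFrom (hf : PiecewiseLipschitzOn f) :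
    ∃ (P : Finset ℝ) (K : ℝ), ∀ (k : ℝ → ℝ) (lo M : ℝ), (∀ a b, |k a - k b| ≤ |a - b|) →
      lo ≤ 0 → 0 ≤ lo + M → (∀ s ∈ Ioo (-1 : ℝ) 1, k (f s) ∈ Icc lo (lo + M)) →
      LipschitzAwayFrom ((Ioo (-1 : ℝ) 1).indicator fun s => k (f s)) P K M := by
  obtain ⟨m, y, -, h0, hm, hlt, hlip⟩ := hf
  choose! K hK using hlip
  refine ⟨(Finset.range (m + 1)).image y, ∑ j ∈ Finset.range m, (K j : ℝ),
    fun k lo M hk hlo hM hrange => ?_⟩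
  have hmem : ∀ j ≤ m, y j ∈ (Finset.range (m + 1)).image y := fun j hj =>
    Finset.mem_image_of_mem y (Finset.mem_range.2 (Nat.lt_succ_of_le hj))
  have hval : ∀ s, (Ioo (-1 : ℝ) 1).indicator (fun s => k (f s)) s ∈ Icc lo (lo + M) := by
    intro s
    rw [indicator_apply]
    split_ifs with hs
    · exact hrange s hs
    · exact ⟨hlo, hM⟩
  have hK0 : 0 ≤ ∑ j ∈ Finset.range m, (K j : ℝ) :=
    Finset.sum_nonneg fun j _ => (K j).coe_nonneg
  refine ⟨hm ▸ hmem m le_rfl, hK0, fun a b => ?_, fun s hs => indicator_of_notMem hs _, ?_⟩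
  · have ha := hval a
    have hb := hval b
    exact abs_le.2 ⟨by linarith [ha.1, hb.2], by linarith [ha.2, hb.1]⟩
  · intro x d hd s hs
    have hs' := abs_lt.1 hs
    have hd1 := hd 1 (hm ▸ hmem m le_rfl)
    have hd2 := hd (-1) (h0 ▸ hmem 0 (Nat.zero_le m))
    by_cases hx : x ∈ Ioo (-1 : ℝ) 1
    · obtain ⟨j, hj, hj1, hj2⟩ := exists_mem_Ico_of_chain (h0.trans_le hx.1.le) m (hm ▸ hx.2)
      have e1 := hd (y j) (hmem j hj.le)
      have e2 := hd (y (j + 1)) (hmem (j + 1) hj)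
      rw [abs_of_nonneg (by linarith)] at e1
      rw [abs_of_neg (by linarith)] at e2
      rw [abs_of_neg (by linarith [hx.2])] at hd1
      rw [abs_of_pos (by linarith [hx.1])] at hd2
      have hsI : s ∈ Ioo (-1 : ℝ) 1 := ⟨by linarith, by linarith⟩
      rw [indicator_of_mem hsI, indicator_of_mem hx]
      have hsj : s ∈ Ioo (y j) (y (j + 1)) := ⟨by linarith, by linarith⟩
      have hxj : x ∈ Ioo (y j) (y (j + 1)) := by
        refine ⟨lt_of_le_of_ne hj1 ?_, hj2⟩
        intro heq
        rw [heq, sub_self] at e1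
        linarith [abs_nonneg (s - x)]
      have h1 := (hK j hj).dist_le_mul s hsj x hxj
      rw [Real.dist_eq, Real.dist_eq] at h1
      have h2 : (K j : ℝ) ≤ ∑ j ∈ Finset.range m, (K j : ℝ) :=
        Finset.single_le_sum (f := fun j => (K j : ℝ)) (fun i _ => (K i).coe_nonneg)
          (Finset.mem_range.2 hj)
      exact (hk _ _).trans (h1.trans (mul_le_mul_of_nonneg_right h2 (abs_nonneg _)))
    · have hsI : s ∉ Ioo (-1 : ℝ) 1 := by
        intro hsI
        rw [mem_Ioo, not_and_or, not_lt, not_lt] at hx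
        rcases hx with hx | hx
        · rw [abs_of_nonpos (by linarith)] at hd2
          linarith [hsI.1]
        · rw [abs_of_nonneg (by linarith)] at hd1
          linarith [hsI.2]
      rw [indicator_of_notMem hsI, indicator_of_notMem hx, sub_self, abs_zero]
      exact mul_nonneg hK0 (abs_nonneg _)

end PiecewiseLipschitzOn

/-- The Hilbert transform of the indicator function of `(-1,1)`. -/
lemma HT_indicator_one {P : Finset ℝ} {K M : ℝ}
    (H : LipschitzAwayFrom ((Ioo (-1 : ℝ) 1).indicator fun _ => 1) P K M) {x : ℝ}
    (hx : x ∉ P) (hxI : x ∈ Ioo (-1 : ℝ) 1) :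
    π * HT ((Ioo (-1 : ℝ) 1).indicator fun _ => 1) x
      = Real.log (1 - x) - Real.log (1 + x) := by
  have h1 : ∀ y : ℝ, 0 < y →
      (cauchyTransform ((Ioo (-1 : ℝ) 1).indicator fun _ => 1) (x + y * I)).re
        = Real.log ((1 - x) ^ 2 + y ^ 2) / 2 - Real.log ((-1 - x) ^ 2 + y ^ 2) / 2 := by
    intro y hy
    rw [H.re_cauchyTransform_eq_integral x hy]
    have hpos : ∀ s : ℝ, 0 < (s - x) ^ 2 + y ^ 2 := fun s => by positivity
    have h2 : ∫ s, (Ioo (-1 : ℝ) 1).indicator (fun _ => (1 : ℝ)) s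
        * ((s - x) / ((s - x) ^ 2 + y ^ 2))
        = ∫ s in (-1 : ℝ)..1, (s - x) / ((s - x) ^ 2 + y ^ 2) := by
      rw [intervalIntegral.integral_of_le (by norm_num), integral_Ioc_eq_integral_Ioo,
        ← integral_indicator measurableSet_Ioo]
      refine integral_congr_ae (Eventually.of_forall fun s => ?_)
      by_cases hs : s ∈ Ioo (-1 : ℝ) 1
      · simp only [indicator_of_mem hs, one_mul]
      · simp only [indicator_of_notMem hs, zero_mul]
    rw [h2]
    refine intervalIntegral.integral_eq_sub_of_hasDerivAt
      (f := fun s => Real.log ((s - x) ^ 2 + y ^ 2) / 2) (fun s _ => ?_) ?_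
    · have h3 := ((((hasDerivAt_id s).sub_const x).pow 2).add_const (y ^ 2)).log (hpos s).ne'
      refine (h3.div_const 2).congr_deriv ?_
      simp
      ring
    · refine Continuous.intervalIntegrable ?_ _ _
      exact Continuous.div (by fun_prop) (by fun_prop) fun s => (hpos s).ne'
  have h2 : Tendsto (fun y : ℝ => Real.log ((1 - x) ^ 2 + y ^ 2) / 2
      - Real.log ((-1 - x) ^ 2 + y ^ 2) / 2) (𝓝[>] 0)
      (𝓝 (Real.log (1 - x) - Real.log (1 + x))) := by
    have e1 : (1 - x) ≠ 0 := by linarith [hxI.2]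
    have e2 : (-1 - x) ≠ 0 := by linarith [hxI.1]
    have hc : ContinuousAt (fun y : ℝ => Real.log ((1 - x) ^ 2 + y ^ 2) / 2
        - Real.log ((-1 - x) ^ 2 + y ^ 2) / 2) 0 := by
      refine ContinuousAt.sub (ContinuousAt.div_const (ContinuousAt.log (by fun_prop) ?_) _)
        (ContinuousAt.div_const (ContinuousAt.log (by fun_prop) ?_) _)
      · positivity
      · positivity
    have := hc.tendsto.mono_left (nhdsWithin_le_nhds (s := Ioi 0))
    convert this using 2
    rw [show (-1 - x) ^ 2 + (0 : ℝ) ^ 2 = (1 + x) ^ 2 by ring,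
      show (1 - x) ^ 2 + (0 : ℝ) ^ 2 = (1 - x) ^ 2 by ring, Real.log_pow, Real.log_pow]
    push_cast
    ring
  refine tendsto_nhds_unique (H.tendsto_re_cauchyTransform hx) (h2.congr' ?_)
  filter_upwards [self_mem_nhdsWithin] with y hy
  exact (h1 y hy).symm

lemma exp_half_log_sub_add {x : ℝ} (hx : x ∈ Ioo (-1 : ℝ) 1) :
    Real.exp ((Real.log (1 - x) - Real.log (1 + x)) / 2)
      + Real.exp (-((Real.log (1 - x) - Real.log (1 + x)) / 2)) = 2 / √(1 - x ^ 2) := by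
  have h1 : 0 < 1 - x := by linarith [hx.2]
  have h2 : 0 < 1 + x := by linarith [hx.1]
  have e : ∀ t : ℝ, 0 < t → Real.exp (Real.log t / 2) = √t := fun t ht => by
    rw [Real.exp_half, Real.exp_log ht]
  have s1 := Real.sqrt_pos.2 h1
  have s2 := Real.sqrt_pos.2 h2
  rw [← neg_div, neg_sub, sub_div, sub_div, Real.exp_sub, Real.exp_sub, e _ h1, e _ h2,
    show 1 - x ^ 2 = (1 - x) * (1 + x) by ring, Real.sqrt_mul h1.le]
  field_simp
  rw [Real.sq_sqrt h1.le, Real.sq_sqrt h2.le]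
  ring

lemma im_exp_add_sub_exp_sub (t g l : ℝ) :
    (Complex.exp (((t + l : ℝ) : ℂ) + ((g + π / 2 : ℝ) : ℂ) * I)
      - Complex.exp (((t - l : ℝ) : ℂ) + ((g - π / 2 : ℝ) : ℂ) * I)).im
      = Real.exp t * Real.cos g * (Real.exp l + Real.exp (-l)) := by
  rw [Complex.sub_im, Complex.exp_im, Complex.exp_im]
  simp only [add_re, ofReal_re, mul_re, I_re, mul_zero, ofReal_im, I_im, mul_one, sub_self,
    add_zero, add_im, mul_im, zero_add]
  rw [Real.sin_add_pi_div_two, Real.sin_sub_pi_div_two, sub_eq_add_neg t l, Real.exp_add,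
    Real.exp_add]
  ring

lemma interval_cauchy_eq_cauchyTransform (k : ℝ → ℝ) (z : ℂ) :
    ∫ s in (-1 : ℝ)..1, (k s : ℂ) / ((s : ℂ) - z)
      = cauchyTransform ((Ioo (-1 : ℝ) 1).indicator k) z := by
  rw [intervalIntegral.integral_of_le (by norm_num), integral_Ioc_eq_integral_Ioo,
    ← integral_indicator measurableSet_Ioo, cauchyTransform]
  refine integral_congr_ae (Eventually.of_forall fun s => ?_)
  by_cases hs : s ∈ Ioo (-1 : ℝ) 1
  · simp only [indicator_of_mem hs]
  · simp [indicator_of_notMem hs]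

lemma cauchyTransform_indicator_add {f : ℝ → ℝ} {P : Finset ℝ} {K M M' : ℝ}
    (Hg : LipschitzAwayFrom ((Ioo (-1 : ℝ) 1).indicator f) P K M)
    (H1 : LipschitzAwayFrom ((Ioo (-1 : ℝ) 1).indicator fun _ => 1) P K M') (c : ℝ)
    {z : ℂ} (hz : 0 < z.im) :
    cauchyTransform ((Ioo (-1 : ℝ) 1).indicator fun s => c + f s) z
      = cauchyTransform ((Ioo (-1 : ℝ) 1).indicator f) z
        + c * cauchyTransform ((Ioo (-1 : ℝ) 1).indicator fun _ => 1) z := by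
  simp only [cauchyTransform]
  rw [← integral_const_mul, ← integral_add (Hg.integrable_cauchy hz)
    ((H1.integrable_cauchy hz).const_mul _)]
  refine integral_congr_ae (Eventually.of_forall fun s => ?_)
  by_cases hs : s ∈ Ioo (-1 : ℝ) 1
  · simp only [indicator_of_mem hs]
    push_cast
    ring
  · simp [indicator_of_notMem hs]

/-- The boundary values of `e^{φ⁺} - e^{φ⁻}` at points of `(-1,1)`. -/
lemma tendsto_im_exp_sub_exp {g : ℝ → ℝ} {P : Finset ℝ} {K M M' : ℝ}
    (Hg : LipschitzAwayFrom ((Ioo (-1 : ℝ) 1).indicator g) P K M)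
    (H1 : LipschitzAwayFrom ((Ioo (-1 : ℝ) 1).indicator fun _ => 1) P K M')
    {x : ℝ} (hx : x ∉ P) (hxI : x ∈ Ioo (-1 : ℝ) 1) :
    Tendsto (fun y : ℝ =>
      (Complex.exp (((1 / π : ℝ) : ℂ)
          * cauchyTransform ((Ioo (-1 : ℝ) 1).indicator fun s => π / 2 + g s) (x + y * I))
        - Complex.exp (((1 / π : ℝ) : ℂ)
          * cauchyTransform ((Ioo (-1 : ℝ) 1).indicator fun s => -(π / 2) + g s)
            (x + y * I))).im) (𝓝[>] 0)
      (𝓝 (Real.exp (HT ((Ioo (-1 : ℝ) 1).indicator g) x) * Real.cos (g x)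
        * (2 / √(1 - x ^ 2)))) := by
  have hg := Hg.tendsto_cauchyTransform hx
  have h1 := H1.tendsto_cauchyTransform hx
  have hl := HT_indicator_one H1 hx hxI
  have key : ∀ c : ℝ, Tendsto (fun y : ℝ => Complex.exp (((1 / π : ℝ) : ℂ)
      * cauchyTransform ((Ioo (-1 : ℝ) 1).indicator fun s => c + g s) (x + y * I))) (𝓝[>] 0)
      (𝓝 (Complex.exp (((HT ((Ioo (-1 : ℝ) 1).indicator g) x
        + c / π * (Real.log (1 - x) - Real.log (1 + x)) : ℝ) : ℂ)
          + ((g x + c : ℝ) : ℂ) * I))) := by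
    intro c
    refine (Complex.continuous_exp.tendsto _).comp ?_
    have h2 := (hg.add (h1.const_mul (c : ℂ))).const_mul ((1 / π : ℝ) : ℂ)
    have e : ((1 / π : ℝ) : ℂ) * ((π : ℂ) * (HT ((Ioo (-1 : ℝ) 1).indicator g) x
          + (Ioo (-1 : ℝ) 1).indicator g x * I)
        + c * ((π : ℂ) * (HT ((Ioo (-1 : ℝ) 1).indicator fun _ => 1) x
          + ((Ioo (-1 : ℝ) 1).indicator (fun _ => (1 : ℝ)) x : ℝ) * I)))
        = ((HT ((Ioo (-1 : ℝ) 1).indicator g) x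
        + c / π * (Real.log (1 - x) - Real.log (1 + x)) : ℝ) : ℂ)
          + ((g x + c : ℝ) : ℂ) * I := by
      rw [← hl, indicator_of_mem hxI, indicator_of_mem hxI]
      have hpi : (π : ℂ) ≠ 0 := by exact_mod_cast Real.pi_ne_zero
      push_cast
      field_simp
      ring
    rw [e] at h2
    refine h2.congr' ?_
    filter_upwards [self_mem_nhdsWithin] with y hy
    rw [cauchyTransform_indicator_add Hg H1 c (by simpa using hy)]
  have h3 := (Complex.continuous_im.tendsto _).comp ((key (π / 2)).sub (key (-(π / 2))))
  have e1 : π / 2 / π * (Real.log (1 - x) - Real.log (1 + x))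
      = (Real.log (1 - x) - Real.log (1 + x)) / 2 := by
    field_simp
  rw [neg_div, neg_mul, e1, ← sub_eq_add_neg, ← sub_eq_add_neg (g x), im_exp_add_sub_exp_sub,
    exp_half_log_sub_add hxI] at h3
  exact h3

/-- Green's representation formula for `t₀`: for every smooth
compactly supported test function `φ` on the closed upper half-plane,
`∫_{-1}^1 t₀ φ(·,0) = (1/2π) ∬_{y>0} [Re(e^{φ⁺}-e^{φ⁻}) ∂φ/∂x - Im(e^{φ⁺}-e^{φ⁻}) ∂φ/∂y]`. -/
theorem stmt5 (f : ℝ → ℝ)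
    (hf_pl : PiecewiseLipschitzOn f)
    (hf_zero : ∀ x, x ∉ Set.Ioo (-1:ℝ) 1 → f x = 0)
    (τ : ℝ → ℝ) (hτ : τ = HT (fun s => Real.arctan (f s)))
    (t0 : ℝ → ℝ)
    (ht0 : ∀ x, t0 x = if x ∈ Set.Ioo (-1:ℝ) 1 then
      Real.exp (τ x) / (Real.pi * Real.sqrt (1 - x ^ 2) * Real.sqrt (1 + f x ^ 2))
      else 0)
    (φp φm : ℂ → ℂ)
    (hφp : ∀ z : ℂ, φp z = (1 / (Real.pi : ℂ)) *
      ∫ s in (-1:ℝ)..1, ((Real.pi / 2 + Real.arctan (f s) : ℝ) : ℂ) / ((s : ℂ) - z))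
    (hφm : ∀ z : ℂ, φm z = (1 / (Real.pi : ℂ)) *
      ∫ s in (-1:ℝ)..1, ((-(Real.pi / 2) + Real.arctan (f s) : ℝ) : ℂ) / ((s : ℂ) - z)) :
    ∀ φ : ℝ × ℝ → ℝ, ContDiff ℝ (⊤ : ℕ∞) φ → HasCompactSupport φ →
      (∫ x in Set.Ioo (-1:ℝ) 1, t0 x * φ (x, 0))
        = (1 / (2 * Real.pi)) *
          ∫ q in {q : ℝ × ℝ | 0 < q.2},
            ((Complex.exp (φp ((q.1 : ℂ) + (q.2 : ℂ) * Complex.I))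
              - Complex.exp (φm ((q.1 : ℂ) + (q.2 : ℂ) * Complex.I))).re
                * fderiv ℝ φ q (1, 0)
            - (Complex.exp (φp ((q.1 : ℂ) + (q.2 : ℂ) * Complex.I))
              - Complex.exp (φm ((q.1 : ℂ) + (q.2 : ℂ) * Complex.I))).im
                * fderiv ℝ φ q (0, 1)) := by
  obtain ⟨B, hB⟩ := hf_pl.exists_bound
  obtain ⟨P, K, hPK⟩ := hf_pl.exists_lipschitzAwayFrom
  have hA : ∀ s ∈ Ioo (-1 : ℝ) 1, |Real.arctan (f s)| ≤ Real.arctan B := by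
    intro s hs
    have := _root_.abs_le.1 (hB s hs)
    refine _root_.abs_le.2 ⟨?_, Real.arctan_strictMono.monotone this.2⟩
    rw [← Real.arctan_neg]
    exact Real.arctan_strictMono.monotone this.1
  have hpi := Real.pi_pos
  have hAlt : Real.arctan B < π / 2 := Real.arctan_lt_pi_div_two B
  have hA0 : 0 ≤ Real.arctan B := (abs_nonneg _).trans (hA 0 (by simp))
  have Hg := hPK Real.arctan (-Real.arctan B) (2 * Real.arctan B) abs_arctan_sub_le
    (by linarith) (by linarith) fun s hs => by
      have := _root_.abs_le.1 (hA s hs)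
      exact ⟨this.1, by linarith [this.2]⟩
  have H1 := hPK (fun _ => 1) 0 1 (by simp) le_rfl (by norm_num) (by simp)
  have Hp := hPK (fun t => π / 2 + Real.arctan t) 0 (π / 2 + Real.arctan B)
    (fun a b => by simpa using abs_arctan_sub_le a b) le_rfl (by linarith) fun s hs => by
      have := _root_.abs_le.1 (hA s hs)
      exact ⟨by linarith [this.1], by linarith [this.2]⟩
  have Hm := hPK (fun t => -(π / 2) + Real.arctan t) (-(π / 2 + Real.arctan B))
    (π / 2 + Real.arctan B) (fun a b => by simpa using abs_arctan_sub_le a b)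
    (by linarith) (by linarith) fun s hs => by
      have := _root_.abs_le.1 (hA s hs)
      exact ⟨by linarith [this.1], by linarith [this.2]⟩
  have hg : (fun s => Real.arctan (f s))
      = (Ioo (-1 : ℝ) 1).indicator fun s => Real.arctan (f s) := by
    ext s
    by_cases hs : s ∈ Ioo (-1 : ℝ) 1
    · rw [indicator_of_mem hs]
    · rw [indicator_of_notMem hs, hf_zero s hs, Real.arctan_zero]
  have hp : ∀ z, φp z = ((1 / π : ℝ) : ℂ) * cauchyTransform
      ((Ioo (-1 : ℝ) 1).indicator fun s => π / 2 + Real.arctan (f s)) z := fun z => by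
    rw [hφp, interval_cauchy_eq_cauchyTransform fun s => π / 2 + Real.arctan (f s)]
    push_cast
    rfl
  have hm : ∀ z, φm z = ((1 / π : ℝ) : ℂ) * cauchyTransform
      ((Ioo (-1 : ℝ) 1).indicator fun s => -(π / 2) + Real.arctan (f s)) z := fun z => by
    rw [hφm, interval_cauchy_eq_cauchyTransform fun s => -(π / 2) + Real.arctan (f s)]
    push_cast
    rfl
  intro φ hφ hsupp
  have hdiff : ∀ z : ℂ, 0 < z.im →
      DifferentiableAt ℂ (fun z => Complex.exp (φp z) - Complex.exp (φm z)) z := by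
    intro z hz
    simp only [hp, hm]
    exact (((Hp.differentiableAt_cauchyTransform hz).const_mul _).cexp).sub
      (((Hm.differentiableAt_cauchyTransform hz).const_mul _).cexp)
  have hbound : ∀ R : ℝ, 0 < R → ∃ b : ℝ → ℝ, IntegrableOn b (Icc (-R) R) ∧
      ∀ᵐ x : ℝ, |x| ≤ R → ∀ y : ℝ, 0 < y →
        ‖Complex.exp (φp (x + y * I)) - Complex.exp (φm (x + y * I))‖ ≤ b x := by
    intro R hR
    set M := π / 2 + Real.arctan B with hM
    refine ⟨fun x => 2 * (Real.exp (2 * K * (R + 1) / π) * (R + 1) ^ (M / π)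
      * ∑ p ∈ P, |x - p| ^ (-(M / π))), ?_, ?_⟩
    · refine Integrable.const_mul (Integrable.const_mul ?_ _) _
      refine integrable_finsetSum _ fun p _ => integrableOn_abs_sub_rpow ?_ p R
      have : M / π < 1 := (div_lt_one hpi).2 (by linarith)
      linarith
    · filter_upwards [LipschitzAwayFrom.ae_notMem P] with x hx hxR y hy
      have hc : |1 / π| = 1 / π := abs_of_pos (by positivity)
      have n1 := Hp.norm_exp_cauchyTransform_le hx (add_le_add_left hxR 1) hy hc
      have n2 := Hm.norm_exp_cauchyTransform_le hx (add_le_add_left hxR 1) hy hc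
      rw [hp, hm, two_mul]
      exact (norm_sub_le _ _).trans (add_le_add n1 n2)
  have hlim : ∀ᵐ x : ℝ, Tendsto (fun y : ℝ =>
      (Complex.exp (φp (x + y * I)) - Complex.exp (φm (x + y * I))).im) (𝓝[>] 0)
      (𝓝 (2 * π * t0 x)) := by
    filter_upwards [LipschitzAwayFrom.ae_notMem P] with x hx
    simp only [hp, hm]
    by_cases hxI : x ∈ Ioo (-1 : ℝ) 1
    · have h1 := tendsto_im_exp_sub_exp Hg H1 hx hxI
      have e : 2 * π * t0 x = Real.exp (HT ((Ioo (-1 : ℝ) 1).indicator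
          fun s => Real.arctan (f s)) x) * Real.cos (Real.arctan (f x))
            * (2 / √(1 - x ^ 2)) := by
        rw [ht0, if_pos hxI, hτ, ← hg, Real.cos_arctan]
        field_simp
      rw [e]
      exact h1
    · have e : 2 * π * t0 x = 0 := by rw [ht0, if_neg hxI, mul_zero]
      have h1 := ((Complex.continuous_exp.tendsto _).comp
        ((Hp.tendsto_cauchyTransform hx).const_mul ((1 / π : ℝ) : ℂ))).sub
        ((Complex.continuous_exp.tendsto _).comp
        ((Hm.tendsto_cauchyTransform hx).const_mul ((1 / π : ℝ) : ℂ)))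
      have h2 := (Complex.continuous_im.tendsto _).comp h1
      rw [e]
      convert h2 using 2
      · simp
      · rw [indicator_of_notMem hxI, indicator_of_notMem hxI]
        simp [Complex.exp_im]
  have hgreen := setIntegral_dbarIntegrand_re hdiff hφ hsupp hbound hlim
  simp only [dbarIntegrand_re] at hgreen
  rw [hgreen]
  have h2 : ∫ x, 2 * π * t0 x * φ (x, 0) = 2 * π * ∫ x in Ioo (-1 : ℝ) 1, t0 x * φ (x, 0) := by
    rw [← integral_const_mul, ← setIntegral_eq_integral_of_forall_compl_eq_zero
      (s := Ioo (-1 : ℝ) 1) (f := fun x => 2 * π * t0 x * φ (x, 0)) fun x hx => ?_]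
    · simp only [mul_assoc]
    · rw [ht0, if_neg hx, mul_zero, zero_mul]
  rw [h2]
  field_simp
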